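/- Let P ⊂ ℝ^d be a very ample lattice d-simplex with d ≥ 2. Then k_P ≤ d + ⌊d/2⌋ − 1. -/

import Mathlib

open Set MeasureTheory
open scoped Pointwise

/-- A point of `ℝ^n` is a lattice point if all its coordinates are integers. -/
def IsLatticePt {n : ℕ} (x : Fin n → ℝ) : Prop := ∀ i, ∃ z : ℤ, x i = (z : ℝ)

/-- The set of lattice points of a subset of `ℝ^n`. -/
def latticePts {n : ℕ} (S : Set (Fin n → ℝ)) : Set (Fin n → ℝ) := {x ∈ S | IsLatticePt x}

/-- `P` is `k`-normal: every lattice point of the dilate `k • P` is a sum of `k`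
lattice points of `P`. -/
def IsKNormal {n : ℕ} (P : Set (Fin n → ℝ)) (k : ℕ) : Prop :=
  ∀ x ∈ latticePts ((k : ℝ) • P),
    ∃ u : Fin k → Fin n → ℝ, (∀ j, u j ∈ latticePts P) ∧ x = ∑ j, u j

/-- The `k`-normality `k_P`: the least positive integer such that `P` is `k`-normal for
all `k ≥ k_P`. -/
noncomputable def kNormality {n : ℕ} (P : Set (Fin n → ℝ)) : ℕ :=
  sInf {m | 0 < m ∧ ∀ k, m ≤ k → IsKNormal P k}

/-- The real cone generated by a set `S` (for convex `S`, all nonnegative multiples of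
points of `S`). -/
def coneOver {n : ℕ} (S : Set (Fin n → ℝ)) : Set (Fin n → ℝ) :=
  {x | ∃ t : ℝ, ∃ p ∈ S, 0 ≤ t ∧ x = t • p}

/-- `P` is very ample: for every vertex (= extreme point) `v` of `P`, every lattice point
of the real cone generated by `P - v` is a finite sum of elements of `(P ∩ M) - v`. -/
def IsVeryAmple {n : ℕ} (P : Set (Fin n → ℝ)) : Prop :=
  ∀ v ∈ P.extremePoints ℝ, ∀ x : Fin n → ℝ, IsLatticePt x →
    x ∈ coneOver ((fun p => p - v) '' P) →
    ∃ (m : ℕ) (u : Fin m → Fin n → ℝ), (∀ j, u j ∈ latticePts P) ∧ x = ∑ j, (u j - v)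

/-- The invariant `d_P`: the smallest positive integer such that
`(k+1)P ∩ M = (P ∩ M) + (kP ∩ M)` for all `k ≥ d_P`. -/
noncomputable def dInv {n : ℕ} (P : Set (Fin n → ℝ)) : ℕ :=
  sInf {m | 0 < m ∧ ∀ k : ℕ, m ≤ k →
    latticePts (((k : ℝ) + 1) • P) = latticePts P + latticePts ((k : ℝ) • P)}

/-- The invariant `ν_P` (relative to a set `V`, typically the vertex set of `P`): the
smallest positive integer such that `(k+1)P ∩ M = V + (kP ∩ M)` for all `k ≥ ν_P`. -/
noncomputable def nuInv {n : ℕ} (V P : Set (Fin n → ℝ)) : ℕ :=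
  sInf {m | 0 < m ∧ ∀ k : ℕ, m ≤ k →
    latticePts (((k : ℝ) + 1) • P) = V + latticePts ((k : ℝ) • P)}

/-- The normalized volume of `P ⊆ ℝ^n`: `n!` times its Euclidean (Lebesgue) volume. -/
noncomputable def nVol {n : ℕ} (P : Set (Fin n → ℝ)) : ℝ :=
  (n.factorial : ℝ) * (volume P).toReal

open Classical in
/-- The degree of a lattice `n`-polytope `P`: `n` if `P` has an interior lattice point,
and otherwise the least `i ≥ 0` such that `(kP)° ∩ M = ∅` for all `1 ≤ k ≤ n - i`. -/
noncomputable def polyDeg {n : ℕ} (P : Set (Fin n → ℝ)) : ℕ :=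
  if (latticePts (interior P)).Nonempty then n
  else sInf {i | ∀ k : ℕ, 1 ≤ k → k ≤ n - i → latticePts (interior ((k : ℝ) • P)) = ∅}

section Cone

variable {ι : Type*} [Fintype ι]

/-- The elements of height one of the cone `Λ ∩ ℝ≥0^ι`. -/
def heightOne (Λ : AddSubgroup (ι → ℝ)) : Set (ι → ℝ) :=
  {a | a ∈ Λ ∧ 0 ≤ a ∧ ∑ i, a i = 1}

lemma nonneg_of_mem_closure_heightOne {Λ : AddSubgroup (ι → ℝ)} {a : ι → ℝ}
    (ha : a ∈ AddSubmonoid.closure (heightOne Λ)) : a ∈ Λ ∧ 0 ≤ a := by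
  induction ha using AddSubmonoid.closure_induction with
  | mem x hx => exact ⟨hx.1, hx.2.1⟩
  | zero => exact ⟨Λ.zero_mem, le_rfl⟩
  | add x y _ _ hx hy => exact ⟨Λ.add_mem hx.1 hy.1, add_nonneg hx.2 hy.2⟩

lemma sum_multiset_heightOne {Λ : AddSubgroup (ι → ℝ)} (s : Multiset (ι → ℝ))
    (hs : ∀ u ∈ s, u ∈ heightOne Λ) : ∑ i, s.sum i = s.card := by
  induction s using Multiset.induction_on with
  | empty => simp
  | cons u s ih =>
    have hu := (hs u (Multiset.mem_cons_self u s)).2.2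
    have := ih fun w hw => hs w (Multiset.mem_cons_of_mem hw)
    simp [Finset.sum_add_distrib, hu, this, add_comm]

variable [DecidableEq ι]

lemma single_mem_heightOne {Λ : AddSubgroup (ι → ℝ)} (hΛ : ∀ i, Pi.single i 1 ∈ Λ) (i : ι) :
    Pi.single i 1 ∈ heightOne Λ :=
  ⟨hΛ i, Pi.single_nonneg.2 zero_le_one, by simp⟩

/-- An abstract form of very ampleness, in barycentric coordinates. -/
def VertexSaturated (Λ : AddSubgroup (ι → ℝ)) : Prop :=
  ∀ (i : ι) (k : ℕ), ∀ a ∈ Λ, 0 ≤ a → ∑ j, a j = k →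
    ∃ n : ℕ, a + n • Pi.single i 1 ∈ AddSubmonoid.closure (heightOne Λ)

lemma VertexSaturated.exists_pair {Λ : AddSubgroup (ι → ℝ)} (hΛ : ∀ i, Pi.single i 1 ∈ Λ)
    (hv : VertexSaturated Λ) (i : ι) {h : ℕ} (hh : 2 ≤ h) {y : ι → ℝ} (hy : y ∈ Λ)
    (hy0 : 0 ≤ y) (hys : ∑ j, y j = h) (hyS : y ∉ AddSubmonoid.closure (heightOne Λ)) :
    ∃ u ∈ heightOne Λ, ∃ w ∈ heightOne Λ, u i + w i < 1 ∧ ∀ l, l ≠ i → u l + w l ≤ y l := by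
  classical
  have hex := hv i h y hy hy0 hys
  have hn := Nat.find_spec hex
  have hmin := fun m (hm : m < Nat.find hex) => Nat.find_min hex hm
  generalize Nat.find hex = n at hn hmin
  obtain _ | n := n
  · exact absurd (by simpa using hn) hyS
  obtain ⟨s, hs, hsum⟩ := AddSubmonoid.exists_multiset_of_mem_closure hn
  have hcard : (s.card : ℝ) = h + (n + 1 : ℕ) := by
    rw [← sum_multiset_heightOne s hs, hsum]
    simp [Finset.sum_add_distrib, hys, ← Finset.mul_sum]
  have hcard : s.card = h + (n + 1) := by exact_mod_cast hcard
  obtain ⟨u, hu⟩ := Multiset.exists_mem_of_ne_zero (s := s) (by rintro rfl; simp at hcard)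
  obtain ⟨s, rfl⟩ := Multiset.exists_cons_of_mem hu
  rw [Multiset.card_cons] at hcard
  obtain ⟨w, hw⟩ := Multiset.exists_mem_of_ne_zero (s := s) (by rintro rfl; simp at hcard; omega)
  obtain ⟨t, rfl⟩ := Multiset.exists_cons_of_mem hw
  have hu1 := hs u (by simp)
  have hw1 := hs w (by simp)
  have ht : t.sum ∈ AddSubmonoid.closure (heightOne Λ) :=
    AddSubmonoid.multiset_sum_mem _ _ fun a ha => AddSubmonoid.subset_closure (hs a (by simp [ha]))
  have ht0 := (nonneg_of_mem_closure_heightOne ht).2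
  rw [Multiset.sum_cons, Multiset.sum_cons] at hsum
  refine ⟨u, hu1, w, hw1, ?_, fun l hl => ?_⟩
  · by_contra! hc
    have hp : u + w - Pi.single i 1 ∈ heightOne Λ := by
      refine ⟨Λ.sub_mem (Λ.add_mem hu1.1 hw1.1) (hΛ i), fun j => ?_, ?_⟩
      · by_cases hj : j = i
        · subst hj
          simpa using hc
        · have := add_nonneg (hu1.2.1 j) (hw1.2.1 j)
          simpa [hj] using this
      · simp [Finset.sum_add_distrib, hu1.2.2, hw1.2.2]
    refine hmin n (Nat.lt_succ_self n) ?_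
    have : y + n • Pi.single i 1 = (u + w - Pi.single i 1) + t.sum := by
      rw [add_smul, one_smul] at hsum
      linear_combination -hsum
    rw [this]
    exact add_mem (AddSubmonoid.subset_closure hp) ht
  · have h1 := congrFun hsum l
    have h2 := ht0 l
    simp [hl] at h1 h2
    linarith

lemma VertexSaturated.exists_sub_nonneg {Λ : AddSubgroup (ι → ℝ)} (hΛ : ∀ i, Pi.single i 1 ∈ Λ)
    (hv : VertexSaturated Λ) {h : ℕ} (hh : 2 ≤ h) (hd : Fintype.card ι ≤ 2 * h) {y : ι → ℝ}
    (hy : y ∈ Λ) (hy0 : 0 ≤ y) (hys : ∑ j, y j = h)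
    (hyS : y ∉ AddSubmonoid.closure (heightOne Λ)) :
    ∃ u ∈ heightOne Λ, 0 ≤ y - u := by
  obtain ⟨i, hi⟩ : ∃ i, 1 / 2 ≤ y i := by
    by_contra! hc
    have hne : (Finset.univ : Finset ι).Nonempty := by
      by_contra hemp
      rw [Finset.not_nonempty_iff_eq_empty] at hemp
      rw [hemp, Finset.sum_empty] at hys
      have : h = 0 := by exact_mod_cast hys.symm
      omega
    have h1 := Finset.sum_lt_sum_of_nonempty hne fun i _ => hc i
    rw [hys] at h1
    have h2 : (Fintype.card ι : ℝ) ≤ 2 * h := by exact_mod_cast hd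
    simp at h1
    linarith
  obtain ⟨u, hu, w, hw, hlt, hle⟩ := hv.exists_pair hΛ i hh hy hy0 hys hyS
  rcases le_total (u i) (w i) with hc | hc
  · refine ⟨u, hu, fun l => ?_⟩
    by_cases hl : l = i
    · subst hl
      simp
      linarith
    · have h1 := hle l hl
      have h2 := hw.2.1 l
      simp at h2 ⊢
      linarith
  · refine ⟨w, hw, fun l => ?_⟩
    by_cases hl : l = i
    · subst hl
      simp
      linarith
    · have h1 := hle l hl
      have h2 := hu.2.1 l
      simp at h2 ⊢
      linarith

lemma VertexSaturated.add_mem_closure {Λ : AddSubgroup (ι → ℝ)} (hΛ : ∀ i, Pi.single i 1 ∈ Λ)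
    (hv : VertexSaturated Λ) (h : ℕ) {y : ι → ℝ} (hy : y ∈ Λ) (hy0 : 0 ≤ y)
    (hys : ∑ j, y j = h) (e : Multiset ι) (he : h ≤ e.card + 1) :
    y + (e.map fun i => Pi.single i 1).sum ∈ AddSubmonoid.closure (heightOne Λ) := by
  have hverts : ∀ e : Multiset ι, (e.map fun i => Pi.single i (1 : ℝ)).sum ∈
      AddSubmonoid.closure (heightOne Λ) := fun e => by
    refine AddSubmonoid.multiset_sum_mem _ _ fun a ha => ?_
    obtain ⟨i, -, rfl⟩ := Multiset.mem_map.1 ha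
    exact AddSubmonoid.subset_closure (single_mem_heightOne hΛ i)
  induction h generalizing y e with
  | zero =>
    have : y = 0 := by
      have h1 := (Finset.sum_eq_zero_iff_of_nonneg fun i _ => hy0 i).1 (hys.trans Nat.cast_zero)
      exact funext fun i => h1 i (Finset.mem_univ i)
    rw [this, zero_add]
    exact hverts e
  | succ h ih =>
    by_cases hyS : y ∈ AddSubmonoid.closure (heightOne Λ)
    · exact add_mem hyS (hverts e)
    obtain rfl | hpos := Nat.eq_zero_or_pos h
    · exact absurd (AddSubmonoid.subset_closure (s := heightOne Λ) ⟨hy, hy0, by simpa using hys⟩) hyS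
    obtain ⟨i, hi⟩ := Multiset.exists_mem_of_ne_zero (s := e) (by rintro rfl; simp at he; omega)
    obtain ⟨e, rfl⟩ := Multiset.exists_cons_of_mem hi
    rw [Multiset.card_cons] at he
    obtain ⟨u, hu, w, hw, hlt, hle⟩ := hv.exists_pair hΛ i (by omega) hy hy0 hys hyS
    have key := ih (y := y + Pi.single i 1 - u - w)
      (Λ.sub_mem (Λ.sub_mem (Λ.add_mem hy (hΛ i)) hu.1) hw.1) (fun l => ?_) ?_ e (by omega)
    · have : y + ((i ::ₘ e).map fun i => Pi.single i (1 : ℝ)).sum =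
          u + w + (y + Pi.single i 1 - u - w + (e.map fun i => Pi.single i 1).sum) := by
        rw [Multiset.map_cons, Multiset.sum_cons]
        abel
      rw [this]
      exact add_mem (add_mem (AddSubmonoid.subset_closure hu) (AddSubmonoid.subset_closure hw)) key
    · by_cases hl : l = i
      · subst hl
        have := hy0 l
        simp at this ⊢
        linarith
      · have := hle l hl
        simp [hl]
        linarith
    · simp [Finset.sum_add_distrib, hu.2.2, hw.2.2, hys]

lemma VertexSaturated.exists_add_of_height {Λ : AddSubgroup (ι → ℝ)}
    (hΛ : ∀ i, Pi.single i 1 ∈ Λ) (hv : VertexSaturated Λ) {m : ℕ} (hm : 1 ≤ m)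
    (hd : Fintype.card ι ≤ 2 * (m + 1)) (h : ℕ) {y : ι → ℝ} (hy : y ∈ Λ) (hy0 : 0 ≤ y)
    (hys : ∑ j, y j = h) :
    ∃ s ∈ AddSubmonoid.closure (heightOne Λ), ∃ z ∈ Λ, 0 ≤ z ∧ y = s + z ∧
      ∃ k ≤ m, ∑ j, z j = (k : ℕ) := by
  induction h generalizing y with
  | zero => exact ⟨0, zero_mem _, y, hy, hy0, by simp, 0, by omega, hys⟩
  | succ h ih =>
    by_cases hle : h + 1 ≤ m
    · exact ⟨0, zero_mem _, y, hy, hy0, by simp, h + 1, hle, hys⟩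
    by_cases hyS : y ∈ AddSubmonoid.closure (heightOne Λ)
    · exact ⟨y, hyS, 0, Λ.zero_mem, le_rfl, by simp, 0, by omega, by simp⟩
    obtain ⟨u, hu, hyu⟩ := hv.exists_sub_nonneg hΛ (by omega) (by omega) hy hy0 hys hyS
    obtain ⟨s, hs, z, hz, hz0, hsz, k, hk, hzk⟩ := ih (Λ.sub_mem hy hu.1) hyu
      (by simp [hu.2.2, hys])
    exact ⟨u + s, add_mem (AddSubmonoid.subset_closure hu) hs, z, hz, hz0,
      by rw [add_assoc, ← hsz]; abel, k, hk, hzk⟩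

lemma VertexSaturated.mem_closure {Λ : AddSubgroup (ι → ℝ)} (hΛ : ∀ i, Pi.single i 1 ∈ Λ)
    (hv : VertexSaturated Λ) {d k : ℕ} (hd : 2 ≤ d) (hcard : Fintype.card ι = d + 1)
    (hk : d + d / 2 - 1 ≤ k) {x : ι → ℝ} (hx : x ∈ Λ) (hx0 : 0 ≤ x) (hxs : ∑ j, x j = k) :
    x ∈ AddSubmonoid.closure (heightOne Λ) := by
  set e : Multiset ι := ∑ i, Multiset.replicate ⌊x i⌋₊ i with he
  have hemap : (e.map fun i => Pi.single i (1 : ℝ)).sum = fun i => (⌊x i⌋₊ : ℝ) := by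
    rw [he, ← Multiset.coe_mapAddMonoidHom, map_sum, Multiset.sum_sum]
    ext j
    simp [Finset.sum_apply, Pi.single_apply]
  have hecard : e.card = ∑ i, ⌊x i⌋₊ := by
    simp [he]
  have hfrac : ∀ i, (⌊x i⌋₊ : ℝ) ≤ x i ∧ x i < ⌊x i⌋₊ + 1 := fun i =>
    ⟨Nat.floor_le (hx0 i), Nat.lt_floor_add_one _⟩
  have hle : e.card ≤ k := by
    have : (∑ i, (⌊x i⌋₊ : ℝ)) ≤ k := hxs ▸ Finset.sum_le_sum fun i _ => (hfrac i).1
    rw [hecard]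
    exact_mod_cast this
  have hlt : k < e.card + (d + 1) := by
    have hne : (Finset.univ : Finset ι).Nonempty := by
      rw [← Finset.card_pos, Finset.card_univ, hcard]
      omega
    have h1 : ∑ i, x i < ∑ i, ((⌊x i⌋₊ : ℝ) + 1) :=
      Finset.sum_lt_sum_of_nonempty hne fun i _ => (hfrac i).2
    rw [hxs, Finset.sum_add_distrib] at h1
    simp only [Finset.sum_const, Finset.card_univ, hcard, nsmul_eq_mul, mul_one] at h1
    rw [hecard]
    exact_mod_cast h1
  have heΛ : (e.map fun i => Pi.single i (1 : ℝ)).sum ∈ Λ :=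
    AddSubmonoid.multiset_sum_mem Λ.toAddSubmonoid _ fun a ha => by
      obtain ⟨i, -, rfl⟩ := Multiset.mem_map.1 ha
      exact hΛ i
  obtain ⟨s, hs, z, hz, hz0, hsz, m, hm, hzm⟩ :=
    hv.exists_add_of_height hΛ (m := d / 2) (by omega) (by omega) (k - e.card)
      (Λ.sub_mem hx heΛ) (fun i => by rw [hemap]; simpa using (hfrac i).1)
      (by rw [hemap, Nat.cast_sub hle, hecard]; simp [hxs])
  have : x = s + (z + (e.map fun i => Pi.single i (1 : ℝ)).sum) := by
    rw [← add_assoc, ← hsz]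
    abel
  rw [this]
  exact add_mem hs (hv.add_mem_closure hΛ m hz hz0 hzm e (by omega))

end Cone

section Simplex

variable {n : ℕ} {ι : Type*} [Fintype ι]

lemma mem_convexHull_range_iff_exists_weights (v : ι → Fin n → ℝ) (x : Fin n → ℝ) :
    x ∈ convexHull ℝ (range v) ↔
      ∃ a : ι → ℝ, 0 ≤ a ∧ ∑ i, a i = 1 ∧ Fintype.linearCombination ℝ v a = x := by
  classical
  have hr : range v = Fintype.linearCombination ℝ v '' range fun i : ι => Pi.single i (1 : ℝ) := by
    rw [← range_comp]
    congr 1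
    ext i
    simp
  rw [hr, ← LinearMap.image_convexHull, convexHull_rangle_single_eq_stdSimplex]
  constructor
  · rintro ⟨a, ha, rfl⟩
    exact ⟨a, ha.1, ha.2, rfl⟩
  · rintro ⟨a, h0, h1, rfl⟩
    exact ⟨a, ⟨h0, h1⟩, rfl⟩

lemma AffineIndependent.eq_of_linearCombination_eq {v : ι → Fin n → ℝ}
    (hind : AffineIndependent ℝ v) {a b : ι → ℝ} (hs : ∑ i, a i = ∑ i, b i)
    (hab : Fintype.linearCombination ℝ v a = Fintype.linearCombination ℝ v b) : a = b := by
  have h := affineIndependent_iff.1 hind Finset.univ (a - b) (by simp [hs]) (by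
    have := sub_eq_zero.2 hab
    rwa [← map_sub, Fintype.linearCombination_apply] at this)
  exact funext fun i => sub_eq_zero.1 (h i (Finset.mem_univ i))

lemma AffineIndependent.mem_extremePoints_convexHull_range {v : ι → Fin n → ℝ}
    (hind : AffineIndependent ℝ v) (i : ι) :
    v i ∈ (convexHull ℝ (range v)).extremePoints ℝ := by
  classical
  rw [mem_extremePoints]
  refine ⟨subset_convexHull ℝ _ (mem_range_self i), fun x hx y hy hxy => ?_⟩
  rw [mem_convexHull_range_iff_exists_weights] at hx hy
  obtain ⟨a, ha0, ha1, rfl⟩ := hx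
  obtain ⟨b, hb0, hb1, rfl⟩ := hy
  obtain ⟨s, t, hs, ht, hst, h⟩ := hxy
  have key : s • a + t • b = Pi.single i 1 := by
    refine hind.eq_of_linearCombination_eq ?_ ?_
    · simp [Finset.sum_add_distrib, ← Finset.mul_sum, ha1, hb1, hst]
    · simpa using h
  have hz : ∀ j, j ≠ i → a j = 0 ∧ b j = 0 := fun j hj => by
    have h1 := congrFun key j
    have h2 := ha0 j
    have h3 := hb0 j
    simp [hj] at h1 h2 h3
    have h4 := mul_nonneg hs.le h2
    have h5 := mul_nonneg ht.le h3
    constructor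
    · rcases mul_eq_zero.1 (by linarith : s * a j = 0) with h | h
      · exact absurd h hs.ne'
      · exact h
    · rcases mul_eq_zero.1 (by linarith : t * b j = 0) with h | h
      · exact absurd h ht.ne'
      · exact h
  have hsingle : ∀ c : ι → ℝ, ∑ j, c j = 1 → (∀ j, j ≠ i → c j = 0) →
      Fintype.linearCombination ℝ v c = v i := fun c hc hc0 => by
    rw [Fintype.sum_eq_single i hc0] at hc
    rw [Fintype.linearCombination_apply, Fintype.sum_eq_single i, hc, one_smul]
    intro j hj
    rw [hc0 j hj, zero_smul]
  exact ⟨hsingle a ha1 fun j hj => (hz j hj).1, hsingle b hb1 fun j hj => (hz j hj).2⟩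

/-- The lattice `ℤ^n` as an additive subgroup of `ℝ^n`. -/
def integerLattice (n : ℕ) : AddSubgroup (Fin n → ℝ) where
  carrier := {x | IsLatticePt x}
  zero_mem' i := ⟨0, by simp⟩
  add_mem' {x y} hx hy i := by
    obtain ⟨a, ha⟩ := hx i
    obtain ⟨b, hb⟩ := hy i
    exact ⟨a + b, by simp [ha, hb]⟩
  neg_mem' {x} hx i := by
    obtain ⟨a, ha⟩ := hx i
    exact ⟨-a, by simp [ha]⟩

/-- The weight vectors whose linear combination of the points `v i` is a lattice point. -/
noncomputable def weightLattice (v : ι → Fin n → ℝ) : AddSubgroup (ι → ℝ) :=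
  (integerLattice n).comap (Fintype.linearCombination ℝ v).toAddMonoidHom

lemma mem_weightLattice {v : ι → Fin n → ℝ} {a : ι → ℝ} :
    a ∈ weightLattice v ↔ IsLatticePt (Fintype.linearCombination ℝ v a) := Iff.rfl

lemma mem_latticePts_convexHull_range_iff (v : ι → Fin n → ℝ) (x : Fin n → ℝ) :
    x ∈ latticePts (convexHull ℝ (range v)) ↔
      ∃ a ∈ heightOne (weightLattice v), Fintype.linearCombination ℝ v a = x := by
  constructor
  · rintro ⟨hx, hl⟩
    obtain ⟨a, h0, h1, rfl⟩ := (mem_convexHull_range_iff_exists_weights v x).1 hx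
    exact ⟨a, ⟨hl, h0, h1⟩, rfl⟩
  · rintro ⟨a, ⟨hl, h0, h1⟩, rfl⟩
    exact ⟨(mem_convexHull_range_iff_exists_weights v _).2 ⟨a, h0, h1, rfl⟩, hl⟩

lemma single_mem_weightLattice [DecidableEq ι] {v : ι → Fin n → ℝ}
    (hlat : ∀ i, IsLatticePt (v i)) (i : ι) : Pi.single i 1 ∈ weightLattice v := by
  rw [mem_weightLattice]
  simpa using hlat i

lemma IsVeryAmple.vertexSaturated [DecidableEq ι] {v : ι → Fin n → ℝ}
    (hlat : ∀ i, IsLatticePt (v i)) (hind : AffineIndependent ℝ v)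
    (hva : IsVeryAmple (convexHull ℝ (range v))) : VertexSaturated (weightLattice v) := by
  intro i k a ha ha0 hak
  have hsingle : Fintype.linearCombination ℝ v (Pi.single i 1) = v i := by simp
  have hcone : Fintype.linearCombination ℝ v (a - k • Pi.single i 1) ∈
      coneOver ((fun p => p - v i) '' convexHull ℝ (range v)) := by
    rw [map_sub, map_nsmul, hsingle]
    obtain rfl | hk := Nat.eq_zero_or_pos k
    · have : a = 0 := by
        have h1 := (Finset.sum_eq_zero_iff_of_nonneg fun i _ => ha0 i).1 (hak.trans Nat.cast_zero)
        exact funext fun i => h1 i (Finset.mem_univ i)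
      exact ⟨0, v i - v i, ⟨v i, subset_convexHull ℝ _ (mem_range_self i), rfl⟩, le_rfl, by
        simp [this]⟩
    · have hk' : (0 : ℝ) < k := by exact_mod_cast hk
      refine ⟨k, Fintype.linearCombination ℝ v ((k : ℝ)⁻¹ • a) - v i, ⟨_, ?_, rfl⟩, hk'.le, ?_⟩
      · rw [mem_convexHull_range_iff_exists_weights]
        refine ⟨_, smul_nonneg (inv_nonneg.2 hk'.le) ha0, ?_, rfl⟩
        simp only [Pi.smul_apply, smul_eq_mul, ← Finset.mul_sum, hak]
        exact inv_mul_cancel₀ hk'.ne'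
      · rw [map_smul, smul_sub, smul_inv_smul₀ hk'.ne', Nat.cast_smul_eq_nsmul]
  obtain ⟨m, u, hu, hsum⟩ := hva (v i) (hind.mem_extremePoints_convexHull_range i)
    (Fintype.linearCombination ℝ v (a - k • Pi.single i 1))
    ((weightLattice v).sub_mem ha
      ((weightLattice v).nsmul_mem (single_mem_weightLattice hlat i) k)) hcone
  choose w hw hwu using fun j => (mem_latticePts_convexHull_range_iff v (u j)).1 (hu j)
  refine ⟨m, ?_⟩
  have key : a + m • Pi.single i 1 = ∑ j, w j + k • Pi.single i 1 := by
    refine hind.eq_of_linearCombination_eq ?_ ?_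
    · simp only [Pi.add_apply, Pi.smul_apply, Finset.sum_apply, Finset.sum_add_distrib, hak]
      rw [Finset.sum_comm]
      simp [fun j => (hw j).2.2, ← Finset.mul_sum, add_comm]
    · rw [map_sub, map_nsmul, hsingle] at hsum
      rw [map_add, map_add, map_sum, map_nsmul, map_nsmul, hsingle]
      simp only [hwu]
      rw [Finset.sum_sub_distrib, Finset.sum_const, Finset.card_univ, Fintype.card_fin] at hsum
      rw [sub_eq_sub_iff_add_eq_add] at hsum
      exact hsum
  rw [key]
  exact add_mem (sum_mem fun j _ => AddSubmonoid.subset_closure (hw j))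
    (nsmul_mem (AddSubmonoid.subset_closure
      (single_mem_heightOne (single_mem_weightLattice hlat) i)) k)

end Simplex

/-- Ogata: `k_P ≤ d + ⌊d/2⌋ - 1` for very ample simplices with `d ≥ 2`. -/
theorem stmt14 {d : ℕ} (v : Fin (d + 1) → Fin d → ℝ)
    (hlat : ∀ i, IsLatticePt (v i)) (hind : AffineIndependent ℝ v) (hd : 2 ≤ d)
    (hva : IsVeryAmple (convexHull ℝ (Set.range v))) :
    kNormality (convexHull ℝ (Set.range v)) ≤ d + d / 2 - 1 := by
  classical
  have hΛ := single_mem_weightLattice (v := v) hlat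
  have hv := hva.vertexSaturated hlat hind
  refine Nat.sInf_le ⟨by omega, fun k hk x hx => ?_⟩
  obtain ⟨⟨p, hp, rfl⟩, hxl⟩ := hx
  obtain ⟨a, ha0, ha1, rfl⟩ := (mem_convexHull_range_iff_exists_weights v p).1 hp
  have hka : (k : ℝ) • a ∈ weightLattice v := by
    rw [mem_weightLattice, map_smul]
    exact hxl
  have hks : ∑ i, ((k : ℝ) • a) i = k := by
    simp [← Finset.mul_sum, ha1]
  have hmem := hv.mem_closure hΛ hd (by simp) hk hka (smul_nonneg k.cast_nonneg ha0) hks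
  obtain ⟨s, hs, hsum⟩ := AddSubmonoid.exists_multiset_of_mem_closure hmem
  have hcard : s.card = k := by
    have := sum_multiset_heightOne s hs
    rw [hsum, hks] at this
    exact_mod_cast this.symm
  induction s using Quotient.inductionOn with
  | _ l =>
    simp only [Multiset.quot_mk_to_coe, Multiset.coe_card, Multiset.sum_coe,
      Multiset.mem_coe] at hs hsum hcard
    subst hcard
    refine ⟨fun j => Fintype.linearCombination ℝ v (l.get j), fun j => ?_, ?_⟩
    · exact (mem_latticePts_convexHull_range_iff v _).2 ⟨_, hs _ (l.get_mem j), rfl⟩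
    · change (l.length : ℝ) • Fintype.linearCombination ℝ v a = _
      rw [← map_smul, ← hsum, ← map_sum]
      congr 1
      simp [Fin.sum_univ_getElem]
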